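/- Define the polynomial g(x,y) = 256*x^8 + 2080*x^6 - 41685*x^2 + 44100 - 25356*y^2 + 5353*y^4 - 4751*x^4 - 488*y^6 - 3360*y^4*x^2 - 4680*y^2*x^4 + 528*y^4*x^4 + 640*x^6*y^2 + 160*y^6*x^2 + 16*y^8 + 21410*x^2*y^2. Then the set of real points (x,y) with g(x,y) = 0, ∂g/∂x(x,y) = 0 and ∂g/∂y(x,y) = 0 is exactly the two-element set {(0, sqrt(6)), (0, -sqrt(6))}. -/

import Mathlib

/-- The polynomial defining the parallel lines at offset r = 1/2 to the ellipse
y^2/9 + x^2/(9/4) = 1. -/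
noncomputable def g15 (x y : ℝ) : ℝ :=
  256*x^8 + 2080*x^6 - 41685*x^2 + 44100 - 25356*y^2 + 5353*y^4 - 4751*x^4 - 488*y^6 -
    3360*y^4*x^2 - 4680*y^2*x^4 + 528*y^4*x^4 + 640*x^6*y^2 + 160*y^6*x^2 + 16*y^8 +
    21410*x^2*y^2

/-- Off the axes (u = x^2, v = y^2) the only real singular point has u < 0. -/
theorem no_generic (u v : ℝ) (hu0 : 0 < u)
    (h : 256*u^4 + 2080*u^3 - 41685*u + 44100 - 25356*v + 5353*v^2 - 4751*u^2 - 488*v^3 -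
      3360*v^2*u - 4680*v*u^2 + 528*v^2*u^2 + 640*u^3*v + 160*v^3*u + 16*v^4 + 21410*u*v = 0)
    (hu : 1024*u^3 + 6240*u^2 - 41685 - 9502*u - 3360*v^2 - 9360*v*u + 1056*v^2*u +
      1920*u^2*v + 160*v^3 + 21410*v = 0)
    (hv : -25356 + 10706*v - 1464*v^2 - 6720*v*u - 4680*u^2 + 1056*v*u^2 + 640*u^3 +
      480*v^2*u + 64*v^3 + 21410*u = 0) : False := by
  have hp : (2*(23-2*u-2*v)^3 - 2187)^2 = 0 := by
    linear_combination ((-74)*u^2*v^0 +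
      (-1123/16)*u^1*v^1 +
      (-1469/16)*u^0*v^2 +
      (-9594925/2048)*u^0*v^0 +
      (395681/512)*u^0*v^1 +
      (-32189/64)*u^1*v^0 +
      (39/4)*u^1*v^2 +
      (15/4)*u^0*v^3 +
      (6)*u^2*v^1)*h +
      ((-241697/1024)*u^0*v^2 +
      (8487479/4096)*u^1*v^0 +
      (-27917741/6144)*u^0*v^0 +
      (7530141/4096)*u^0*v^1 +
      (-421435/1024)*u^1*v^1 +
      (37003/256)*u^2*v^0 +
      (459/32)*u^0*v^3 +
      (849/16)*u^1*v^2 +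
      (-27/8)*u^2*v^2 +
      (867/32)*u^2*v^1 +
      (75/4)*u^3*v^0 +
      (-3/8)*u^0*v^4 +
      (-9/4)*u^1*v^3 +
      (-3/2)*u^3*v^1)*hu +
      ((-492069049/24576)*u^0*v^0 +
      (1848597/1024)*u^0*v^1 +
      (-355105/512)*u^1*v^0 +
      (-7347/512)*u^0*v^2)*hv
  have hq : (243*u - 16*((23-2*u-2*v)/6-9/4)^3)^2 = 0 := by
    linear_combination ((250/729)*u^2*v^0 +
      (7301/11664)*u^1*v^1 +
      (1771/11664)*u^0*v^2 +
      (-84522517/1492992)*u^0*v^0 +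
      (919913/373248)*u^0*v^1 +
      (246451/46656)*u^1*v^0 +
      (13/972)*u^1*v^2 +
      (5/972)*u^0*v^3 +
      (2/243)*u^2*v^1)*h +
      ((167191/746496)*u^0*v^2 +
      (65433071/2985984)*u^1*v^0 +
      (-6713237/4478976)*u^0*v^0 +
      (-687401/995328)*u^0*v^1 +
      (-231571/746496)*u^1*v^1 +
      (-281165/186624)*u^2*v^0 +
      (-7/864)*u^0*v^3 +
      (-365/3888)*u^1*v^2 +
      (-1/216)*u^2*v^2 +
      (-1655/7776)*u^2*v^1 +
      (-83/972)*u^3*v^0 +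
      (-1/1944)*u^0*v^4 +
      (-1/324)*u^1*v^3 +
      (-1/486)*u^3*v^1)*hu +
      ((-1722756481/17915904)*u^0*v^0 +
      (5068607/248832)*u^0*v^1 +
      (-4845097/373248)*u^1*v^0 +
      (-106777/124416)*u^0*v^2)*hv
  have hp' := pow_eq_zero_iff (two_ne_zero) |>.1 hp
  have hq' := pow_eq_zero_iff (two_ne_zero) |>.1 hq
  generalize 23-2*u-2*v = T at hp' hq'
  have hT : T < 27/2 := by
    by_contra hc
    push Not at hc
    have : (27/2:ℝ)^3 ≤ T^3 := by gcongr
    norm_num at this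
    linarith
  have h3 : 0 < (9/4 - T/6)^3 := by
    apply pow_pos
    linarith
  have : (9/4 - T/6)^3 = -(T/6-9/4)^3 := by ring
  linarith

theorem g15_dx (x y : ℝ) : deriv (fun t : ℝ => g15 t y) x =
    2*x*(1024*(x^2)^3 + 6240*(x^2)^2 - 41685 - 9502*x^2 - 3360*(y^2)^2 - 9360*y^2*x^2 +
      1056*(y^2)^2*x^2 + 1920*(x^2)^2*y^2 + 160*(y^2)^3 + 21410*y^2) := by
  have e : (fun t : ℝ => g15 t y) = fun t : ℝ => 256*t^8 + (2080+640*y^2)*t^6 +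
      (-4751-4680*y^2+528*y^4)*t^4 + (-41685-3360*y^4+160*y^6+21410*y^2)*t^2 +
      (44100 - 25356*y^2 + 5353*y^4 - 488*y^6 + 16*y^8) := by
    funext t; unfold g15; ring
  rw [e]
  have hd := (((((hasDerivAt_pow 8 x).const_mul 256).add
    ((hasDerivAt_pow 6 x).const_mul (2080+640*y^2))).add
    ((hasDerivAt_pow 4 x).const_mul (-4751-4680*y^2+528*y^4))).add
    ((hasDerivAt_pow 2 x).const_mul (-41685-3360*y^4+160*y^6+21410*y^2))).add_const
    (44100 - 25356*y^2 + 5353*y^4 - 488*y^6 + 16*y^8)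
  refine hd.deriv.trans ?_
  norm_num
  ring

theorem g15_dy (x y : ℝ) : deriv (fun t : ℝ => g15 x t) y =
    2*y*(-25356 + 10706*y^2 - 1464*(y^2)^2 - 6720*y^2*x^2 - 4680*(x^2)^2 +
      1056*y^2*(x^2)^2 + 640*(x^2)^3 + 480*(y^2)^2*x^2 + 64*(y^2)^3 + 21410*x^2) := by
  have e : (fun t : ℝ => g15 x t) = fun t : ℝ => 16*t^8 + (-488+160*x^2)*t^6 +
      (5353-3360*x^2+528*x^4)*t^4 + (-25356-4680*x^4+640*x^6+21410*x^2)*t^2 +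
      (256*x^8 + 2080*x^6 - 41685*x^2 + 44100 - 4751*x^4) := by
    funext t; unfold g15; ring
  rw [e]
  have hd := (((((hasDerivAt_pow 8 y).const_mul 16).add
    ((hasDerivAt_pow 6 y).const_mul (-488+160*x^2))).add
    ((hasDerivAt_pow 4 y).const_mul (5353-3360*x^2+528*x^4))).add
    ((hasDerivAt_pow 2 y).const_mul (-25356-4680*x^4+640*x^6+21410*x^2))).add_const
    (256*x^8 + 2080*x^6 - 41685*x^2 + 44100 - 4751*x^4)
  refine hd.deriv.trans ?_
  norm_num
  ring

theorem ellipse_subcritical_two_singular_points :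
    {q : ℝ × ℝ | g15 q.1 q.2 = 0 ∧
        deriv (fun t : ℝ => g15 t q.2) q.1 = 0 ∧
        deriv (fun t : ℝ => g15 q.1 t) q.2 = 0}
      = {((0 : ℝ), Real.sqrt 6), ((0 : ℝ), -Real.sqrt 6)} := by
  have h6 : Real.sqrt 6 ^ 2 = 6 := Real.sq_sqrt (by norm_num)
  ext ⟨x, y⟩
  simp only [Set.mem_setOf_eq, Set.mem_insert_iff, Set.mem_singleton_iff, Prod.mk.injEq]
  rw [g15_dx, g15_dy]
  constructor
  · rintro ⟨h, hx, hy⟩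
    by_cases x0 : x = 0
    · subst x0
      have hv : y^2 = 6 := by
        have hf : (y^2-6)^2*((4*y^2-49)*(4*y^2-25)) = 0 := by
          unfold g15 at h
          linear_combination h
        have y0 : y ≠ 0 := by
          rintro rfl
          norm_num at hf
        have hy' := (mul_eq_zero.1 hy).resolve_left (by simpa using y0)
        rcases mul_eq_zero.1 hf with h1 | h1
        · have := pow_eq_zero_iff (two_ne_zero) |>.1 h1
          linarith
        · exfalso
          rcases mul_eq_zero.1 h1 with h2 | h2
          · have : y^2 = 49/4 := by linarith
            rw [this] at hy'
            norm_num at hy'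
          · have : y^2 = 25/4 := by linarith
            rw [this] at hy'
            norm_num at hy'
      have : (y - Real.sqrt 6) * (y + Real.sqrt 6) = 0 := by
        linear_combination hv - h6
      rcases mul_eq_zero.1 this with h1 | h1
      · left; exact ⟨rfl, by linarith⟩
      · right; exact ⟨rfl, by linarith⟩
    · exfalso
      have hx' := (mul_eq_zero.1 hx).resolve_left (by simpa using x0)
      have hu0 : 0 < x^2 := by positivity
      by_cases y0 : y = 0
      · subst y0
        have hf : (x^2-1)*(x^2-4)*(16*x^2+105)^2 = 0 := by
          unfold g15 at h
          linear_combination h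
        have h3 : (16*x^2+105)^2 ≠ 0 := by positivity
        rcases mul_eq_zero.1 ((mul_eq_zero.1 hf).resolve_right h3) with h2 | h2
        · have : x^2 = 1 := by linarith
          rw [this] at hx'
          norm_num at hx'
        · have : x^2 = 4 := by linarith
          rw [this] at hx'
          norm_num at hx'
      · have hy' := (mul_eq_zero.1 hy).resolve_left (by simpa using y0)
        refine no_generic (x^2) (y^2) hu0 ?_ hx' hy'
        unfold g15 at h
        linear_combination h
  · have key : ∀ z : ℝ, z^2 = 6 → g15 0 z = 0 := by
      intro z hz
      have : g15 0 z = (z^2-6)^2*((4*z^2-49)*(4*z^2-25)) := by unfold g15; ring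
      rw [this, hz]; norm_num
    rintro (⟨rfl, rfl⟩ | ⟨rfl, rfl⟩)
    · refine ⟨key _ h6, by simp, ?_⟩
      rw [h6]; norm_num
    · refine ⟨key _ (by rw [neg_sq, h6]), by simp, ?_⟩
      rw [neg_sq, h6]; norm_num
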